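/- Let A > 0, R > 0, M ≥ 0, and let g : [π, 2π] → ℝ be continuously differentiable with |g(τ)| ≤ M·sin²(τ) and |g'(τ)| ≤ M·(-sin τ) for all τ ∈ [π, 2π]. Then there exists a constant κ > 0, depending only on A and R, such that for every ε ∈ (0,1], ( ∫_π^{2π} ∫_0^R ( g'(τ) + g(τ)·A·η·cos(τ)/ε )² · exp(2·A·sin(τ)·η/ε) dη dτ )^{1/2} ≤ κ·M·√ε. Equivalently, for the corrector φ⁰(η,τ) = g(τ)·exp(A·sin(τ)·η/ε) one has ‖∂φ⁰/∂τ‖_{L²((0,R)×(π,2π))} ≤ κ·M·√ε. -/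

import Mathlib

open Real

/-- The integral over `[0, R]` of `s * exp (-(c * s * η))` is at most `1 / c`, uniformly in `s`. -/
lemma integral_mul_exp_neg_le (c s R : ℝ) (hc : 0 < c) :
    ∫ η in (0 : ℝ)..R, s * exp (-(c * s * η)) ≤ 1 / c := by
  have hderiv : ∀ η ∈ Set.uIcc 0 R,
      HasDerivAt (fun η => -(1 / c) * exp (-(c * s * η))) (s * exp (-(c * s * η))) η := by
    intro η _
    have h := ((((hasDerivAt_id η).const_mul (c * s)).neg).exp).const_mul (-(1 / c))
    refine h.congr_deriv ?_
    simp only [Pi.neg_apply, id_eq]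
    field_simp
  rw [intervalIntegral.integral_eq_sub_of_hasDerivAt hderiv
    (Continuous.intervalIntegrable (by fun_prop) _ _)]
  have : 0 ≤ 1 / c * exp (-(c * s * R)) := by positivity
  simp only [mul_zero, neg_zero, exp_zero]
  linarith

/-- Half of the exponential decay absorbs the linear factor. -/
lemma one_add_sq_mul_exp_neg_le {x : ℝ} (hx : 0 ≤ x) :
    (1 + x) ^ 2 * exp (-(2 * x)) ≤ 4 * exp (-x) := by
  have h : (1 + x) ^ 2 ≤ 4 * exp x := by
    have h1 := add_one_le_exp (x / 2)
    have h2 : exp x = exp (x / 2) ^ 2 := by rw [← exp_nat_mul]; congr 1; push_cast; ring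
    rw [h2]
    nlinarith
  calc (1 + x) ^ 2 * exp (-(2 * x)) ≤ 4 * exp x * exp (-(2 * x)) := by gcongr
    _ = 4 * exp (-x) := by rw [mul_assoc, ← exp_add]; congr 2; ring

/-- Pointwise bound for the squared tangential derivative of the corrector, with `s = -sin τ`,
`p = g' τ`, `q = g τ` and `k = cos τ`. -/
lemma sq_corrector_deriv_le {A M s p q k ε η : ℝ} (hA : 0 < A) (hM : 0 ≤ M) (hs : 0 ≤ s)
    (hs1 : s ≤ 1) (hk : |k| ≤ 1) (hp : |p| ≤ M * s) (hq : |q| ≤ M * s ^ 2)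
    (hε : 0 < ε) (hη : 0 ≤ η) :
    (p + q * A * η * k / ε) ^ 2 * exp (-(2 * A * s * η / ε)) ≤
      4 * M ^ 2 * (s * exp (-(A / ε * s * η))) := by
  set x := A / ε * s * η with hx_def
  have hx : 0 ≤ x := by positivity
  have hterm : |q * A * η * k / ε| ≤ M * s * x := by
    have e : |q * A * η * k / ε| = |q| * (A * η / ε) * |k| := by
      rw [abs_div, abs_mul, abs_mul, abs_mul, abs_of_pos hA, abs_of_nonneg hη, abs_of_pos hε]
      ring
    calc |q * A * η * k / ε| = |q| * (A * η / ε) * |k| := e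
      _ ≤ M * s ^ 2 * (A * η / ε) * 1 := by gcongr
      _ = M * s * x := by rw [hx_def]; ring
  have hsum : |p + q * A * η * k / ε| ≤ M * s * (1 + x) :=
    (abs_add_le _ _).trans (by linarith)
  calc (p + q * A * η * k / ε) ^ 2 * exp (-(2 * A * s * η / ε))
      = |p + q * A * η * k / ε| ^ 2 * exp (-(2 * x)) := by
        rw [sq_abs, hx_def]; congr 3; ring
    _ ≤ (M * s * (1 + x)) ^ 2 * exp (-(2 * x)) := by gcongr
    _ = M ^ 2 * (s * s) * ((1 + x) ^ 2 * exp (-(2 * x))) := by ring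
    _ ≤ M ^ 2 * (s * 1) * (4 * exp (-x)) := by
        have := one_add_sq_mul_exp_neg_le hx
        gcongr M ^ 2 * (s * ?_) * ?_
    _ = 4 * M ^ 2 * (s * exp (-x)) := by ring

/-- for the corrector `φ⁰(η,τ) = g(τ)·exp(A·sin(τ)·η/ε)` with
`g` continuously differentiable, `|g(τ)| ≤ M·sin²τ` and `|g'(τ)| ≤ M·(-sin τ)`,
one has `‖∂φ⁰/∂τ‖_{L²((0,R)×(π,2π))} ≤ κ·M·√ε` with `κ` depending only on
`A` and `R`. -/
theorem stmt12 (A R : ℝ) (hA : 0 < A) (hR : 0 < R) :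
    ∃ κ > (0 : ℝ), ∀ M : ℝ, 0 ≤ M → ∀ g : ℝ → ℝ, ContDiff ℝ 1 g →
      (∀ τ ∈ Set.Icc π (2 * π), |g τ| ≤ M * (Real.sin τ) ^ 2) →
      (∀ τ ∈ Set.Icc π (2 * π), |deriv g τ| ≤ M * (-Real.sin τ)) →
      ∀ ε ∈ Set.Ioc (0 : ℝ) 1,
        (∫ τ in π..(2 * π), ∫ η in (0 : ℝ)..R,
            (deriv g τ + g τ * A * η * Real.cos τ / ε) ^ 2 *
              Real.exp (2 * A * Real.sin τ * η / ε)) ^ (1 / 2 : ℝ)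
          ≤ κ * M * Real.sqrt ε := by
  refine ⟨sqrt (4 * π / A), by positivity, ?_⟩
  intro M hM g _ hg hg' ε hε
  obtain ⟨hε, -⟩ := hε
  have hinner : ∀ τ ∈ Set.uIoc π (2 * π), ‖∫ η in (0 : ℝ)..R,
      (deriv g τ + g τ * A * η * Real.cos τ / ε) ^ 2 *
        Real.exp (2 * A * Real.sin τ * η / ε)‖ ≤ 4 * M ^ 2 * (ε / A) := by
    intro τ hτ
    rw [Set.uIoc_of_le (by linarith [pi_pos])] at hτ
    have hτ' : τ ∈ Set.Icc π (2 * π) := ⟨hτ.1.le, hτ.2⟩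
    have hs : 0 ≤ -sin τ := by
      have := sin_nonneg_of_nonneg_of_le_pi (x := τ - π) (by linarith [hτ.1]) (by linarith [hτ.2])
      rwa [sin_sub_pi] at this
    have hbound : ∀ η ∈ Set.Ioc 0 R,
        ‖(deriv g τ + g τ * A * η * Real.cos τ / ε) ^ 2 *
          Real.exp (2 * A * Real.sin τ * η / ε)‖ ≤
        4 * M ^ 2 * (-sin τ * exp (-(A / ε * -sin τ * η))) := by
      intro η hη
      rw [Real.norm_of_nonneg (by positivity)]
      have h := sq_corrector_deriv_le hA hM hs (by linarith [neg_one_le_sin τ])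
        (abs_cos_le_one τ) (hg' τ hτ') (by simpa using hg τ hτ') hε hη.1.le
      convert h using 3
      ring
    calc _ ≤ ∫ η in (0 : ℝ)..R, 4 * M ^ 2 * (-sin τ * exp (-(A / ε * -sin τ * η))) :=
          intervalIntegral.norm_integral_le_of_norm_le hR.le
            (Filter.Eventually.of_forall hbound)
            (Continuous.intervalIntegrable (by fun_prop) _ _)
      _ = 4 * M ^ 2 * ∫ η in (0 : ℝ)..R, -sin τ * exp (-(A / ε * -sin τ * η)) :=
          intervalIntegral.integral_const_mul _ _
      _ ≤ 4 * M ^ 2 * (1 / (A / ε)) := by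
          gcongr
          exact integral_mul_exp_neg_le _ _ _ (by positivity)
      _ = 4 * M ^ 2 * (ε / A) := by rw [one_div_div]
  have houter := (le_abs_self _).trans
    (intervalIntegral.norm_integral_le_of_norm_le_const hinner)
  rw [← sqrt_eq_rpow]
  refine sqrt_le_iff.mpr ⟨by positivity, houter.trans_eq ?_⟩
  rw [mul_pow, mul_pow, sq_sqrt (by positivity), sq_sqrt hε.le,
    abs_of_nonneg (by linarith [pi_pos])]
  ring
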